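/- Let S = {0 = s₀ < s₁ < … < s_n} be a compact distance set whose partition into blocks is {0} ∪ B₁ ∪ … ∪ B_k with k ≥ 2, let S⁺ = S∖B₁, and let L be a finite S⁺-metric space. Let U be a countably infinite S-metric space spanned by L such that: (i) every finite S-metric space spanned by L embeds isometrically into U; and (ii) for every finite S-metric space A spanned by L and every pair of isometric embeddings f, g : A → U there is a surjective self-isometry h of U with f = h ∘ g. Then every finite S-metric space M spanned by L has finite big Ramsey degree in U: there exists a positive integer T such that for every k' ≥ 2 and every coloring χ of the set of isometric embeddings of M into U with k' colors, there is an isometric embedding w of U into itself such that {χ(w ∘ f) : f an isometric embedding of M into U} has at most T elements. -/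

import Mathlib

/-- `s` is a jump number of the finite set `S = {0 = s₀ < s₁ < … < s_n}`. -/
def JumpNumber (S : Finset ℝ) (s : ℝ) : Prop :=
  s ∈ S ∧ ∀ t ∈ S, s < t → 2 * s < t

/-- `x ≈ y`: `x` and `y` lie in the same block of `S`. -/
def SameBlock (S : Finset ℝ) (x y : ℝ) : Prop :=
  x ∈ S ∧ y ∈ S ∧
    ((x = 0 ∧ y = 0) ∨
      (x ≠ 0 ∧ y ≠ 0 ∧ ∀ j, JumpNumber S j → ¬ (min x y ≤ j ∧ j < max x y)))

/-- `S` is a compact distance set: for nonzero `x, y ∈ S`,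
`|x − y| ≤ s₁` iff `x ≈ y`. -/
def CompactDistanceSet (S : Finset ℝ) (s1 : ℝ) : Prop :=
  ∀ x ∈ S, ∀ y ∈ S, x ≠ 0 → y ≠ 0 → (|x - y| ≤ s1 ↔ SameBlock S x y)

/-- `d ∈ {0} ∪ B₁`, where `B₁` is the first nontrivial block of `S`. -/
def InLowBlock (S : Finset ℝ) (s1 d : ℝ) : Prop :=
  d = 0 ∨ SameBlock S d s1

/-- The `S⁺`-metric space `L` spans the `S`-metric space `M` (`L ≲ M`). -/
def Spans (S : Finset ℝ) (s1 : ℝ) (L : Type) [MetricSpace L]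
    (M : Type) [MetricSpace M] : Prop :=
  ∃ τ : L → M, Isometry τ ∧
    ∀ m : M, ∃! a : L, InLowBlock S s1 (dist m (τ a))

/-! ### Words and substitution maps -/

/-- substitute parameter `b + i` by the `i`-th letter (from the end) of `a`. -/
def wsubst (b : ℕ) (a : List ℕ) (y : ℕ) : ℕ :=
  if y < b then y else a.reverse.getD (y - b) 0

/-- The word map attached to an infinite parameter word (words are reversed lists). -/
def wordMap (b : ℕ) (w : ℕ → List ℕ) : List ℕ → List ℕ
  | [] => w 0
  | x :: a => (w (a.length + 1)).map (wsubst b (x :: a)) ++ x :: wordMap b w a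

/-! ### Ultrafilter part -/

section UF
open Filter

@[reducible] def listSemigroup : Semigroup (List ℕ) :=
  { mul := fun a b => a ++ b, mul_assoc := List.append_assoc }

attribute [local instance] Ultrafilter.mul Ultrafilter.semigroup listSemigroup

theorem exists_min_idem {T : Type*} [Semigroup T] [TopologicalSpace T] [CompactSpace T] [T2Space T]
    (hc : ∀ r : T, Continuous (· * r)) (C : Set T) (hC : IsClosed C) (hne : C.Nonempty)
    (hmul : ∀ x ∈ C, ∀ y ∈ C, x * y ∈ C) :
    ∃ p ∈ C, p * p = p ∧ ∀ e ∈ C, e * e = e → e * p = e → p * e = e → e = p := by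
  let S : Set (Set T) :=
    { N | IsClosed N ∧ N.Nonempty ∧ N ⊆ C ∧ ∀ x ∈ C, ∀ y ∈ N, x * y ∈ N }
  rsuffices ⟨I, hI⟩ : ∃ N', Minimal (· ∈ S) N'
  · obtain ⟨Icl, Ine, IC, Imul⟩ := hI.prop
    obtain ⟨p, hpI, hpp⟩ := exists_idempotent_in_compact_subsemigroup hc I Ine Icl.isCompact
      (fun x hx y hy => Imul x (IC hx) y hy)
    refine ⟨p, IC hpI, hpp, ?_⟩
    intro e heC hee hep hpe
    have heI : e ∈ I := by rw [← hep]; exact Imul e heC p hpI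
    have : (· * e) '' C = I := by
      apply hI.eq_of_subset
      · refine ⟨(hc e).isClosedMap _ hC, hne.image _, ?_, ?_⟩
        · rintro _ ⟨x, hx, rfl⟩
          exact hmul x hx e heC
        · rintro x hx _ ⟨y, hy, rfl⟩
          exact ⟨x * y, hmul x hx y hy, mul_assoc _ _ _⟩
      · rintro _ ⟨x, hx, rfl⟩
        exact Imul x hx e heI
    rw [← this] at hpI
    obtain ⟨t, ht, hte⟩ := hpI
    have hte' : t * e = p := hte
    have : p * e = p := by rw [← hte', mul_assoc, hee]
    rw [← this, hpe]
  refine zorn_superset _ fun c hcs hch => ?_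
  obtain rfl | hcnemp := c.eq_empty_or_nonempty
  · exact ⟨C, ⟨hC, hne, subset_rfl, hmul⟩, by simp⟩
  refine
    ⟨⋂₀ c, ⟨isClosed_sInter fun t ht => (hcs ht).1, ?_, ?_, fun m hm m' hm' => ?_⟩, fun s hs =>
      Set.sInter_subset_of_mem hs⟩
  · have := hcnemp.coe_sort
    rw [Set.sInter_eq_iInter]
    exact IsCompact.nonempty_iInter_of_directed_nonempty_isCompact_isClosed
      ((↑) : c → Set T) (DirectedOn.directed_val (IsChain.directedOn hch.symm))
      (fun i => (hcs i.prop).2.1) (fun i => (hcs i.prop).1.isCompact) (fun i => (hcs i.prop).1)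
  · obtain ⟨s, hs⟩ := hcnemp
    exact (Set.sInter_subset_of_mem hs).trans (hcs hs).2.2.1
  · rw [Set.mem_sInter] at hm' ⊢
    exact fun t ht => (hcs ht).2.2.2 m hm m' (hm' t ht)

theorem uf_map_mul (f : List ℕ → List ℕ) (hf : ∀ a b, f (a ++ b) = f a ++ f b)
    (U V : Ultrafilter (List ℕ)) : (U * V).map f = U.map f * V.map f := by
  apply Ultrafilter.coe_inj.mp
  apply Filter.ext'
  intro P
  rw [Ultrafilter.eventually_mul]
  simp only [Ultrafilter.coe_map, Filter.eventually_map]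
  rw [Ultrafilter.eventually_mul]
  have : ∀ a b : List ℕ, f (a * b) = f a * f b := hf
  simp only [this]

theorem uf_mem_mul {A B C : Set (List ℕ)} {U V : Ultrafilter (List ℕ)} (hU : A ∈ U) (hV : B ∈ V)
    (h : ∀ a ∈ A, ∀ b ∈ B, a ++ b ∈ C) : C ∈ U * V := by
  change ∀ᶠ m in ((U * V : Ultrafilter _) : Filter (List ℕ)), m ∈ C
  rw [Ultrafilter.eventually_mul]
  filter_upwards [hU] with a ha
  filter_upwards [hV] with b hb
  exact h a ha b hb

def evalAt (b a : ℕ) (y : ℕ) : ℕ := if y = b then a else y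

theorem exists_pq (b : ℕ) : ∃ p q : Ultrafilter (List ℕ), p * p = p ∧
    {l : List ℕ | ∀ y ∈ l, y < b} ∈ p ∧ {l : List ℕ | (∀ y ∈ l, y ≤ b) ∧ b ∈ l} ∈ q ∧
    p * q = q ∧ ∀ a < b, q.map (List.map (evalAt b a)) = p := by
  set A : Set (List ℕ) := {l : List ℕ | ∀ y ∈ l, y < b} with hA
  set V : Set (List ℕ) := {l : List ℕ | (∀ y ∈ l, y ≤ b) ∧ b ∈ l} with hV
  obtain ⟨p, hpA, hpp, hmin⟩ := exists_min_idem (T := Ultrafilter (List ℕ))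
    Ultrafilter.continuous_mul_left {u | A ∈ u} (ultrafilter_isClosed_basic A)
    ⟨pure [], by simp [hA]⟩
    (fun x hx y hy => uf_mem_mul hx hy (by
      intro a ha b hb y hy
      rcases List.mem_append.1 hy with h | h
      · exact ha y h
      · exact hb y h))
  have hpA : A ∈ p := hpA
  have VA : ∀ a ∈ V, ∀ b ∈ A, a ++ b ∈ V := by
    rintro a ⟨ha, hba⟩ c hc
    refine ⟨fun y hy => ?_, by simp [hba]⟩
    rcases List.mem_append.1 hy with h | h
    · exact ha y h
    · exact (hc y h).le
  have AV : ∀ a ∈ A, ∀ b ∈ V, a ++ b ∈ V := by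
    rintro c hc a ⟨ha, hba⟩
    refine ⟨fun y hy => ?_, by simp [hba]⟩
    rcases List.mem_append.1 hy with h | h
    · exact (hc y h).le
    · exact ha y h
  have VV : ∀ a ∈ V, ∀ b ∈ V, a ++ b ∈ V := by
    rintro c hc a ⟨ha, hba⟩
    refine ⟨fun y hy => ?_, by simp [hba]⟩
    rcases List.mem_append.1 hy with h | h
    · exact (hc.1 y h)
    · exact ha y h
  obtain ⟨e, ⟨v, hv, hve⟩, hee⟩ := exists_idempotent_in_compact_subsemigroup
    (M := Ultrafilter (List ℕ)) Ultrafilter.continuous_mul_left ((· * p) '' {u | V ∈ u})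
    ⟨_, ⟨pure [b], by simp [hV], rfl⟩⟩
    ((ultrafilter_isClosed_basic V).isCompact.image (Ultrafilter.continuous_mul_left p))
    (by
      rintro _ ⟨x, hx, rfl⟩ _ ⟨y, hy, rfl⟩
      have h1 : V ∈ x * p := uf_mem_mul hx hpA VA
      have h2 : V ∈ x * p * y := uf_mem_mul h1 hy VV
      refine ⟨x * p * y, h2, ?_⟩
      simp only [mul_assoc])
  have hve : v * p = e := hve
  have hep : e * p = e := by rw [← hve, mul_assoc, hpp]
  have heV : V ∈ e := by rw [← hve]; exact uf_mem_mul hv hpA VA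
  have hqV : V ∈ p * e := uf_mem_mul hpA heV AV
  have hpq : p * (p * e) = p * e := by rw [← mul_assoc, hpp]
  have hqp : (p * e) * p = p * e := by rw [mul_assoc, hep]
  have hqq : (p * e) * (p * e) = p * e := by
    rw [← mul_assoc, hqp, mul_assoc, hee]
  refine ⟨p, p * e, hpp, hpA, hqV, hpq, ?_⟩
  intro a ha
  have hmap : p.map (List.map (evalAt b a)) = p := by
    apply Ultrafilter.coe_inj.mp
    rw [Ultrafilter.coe_map]
    have : List.map (evalAt b a) =ᶠ[p] id := by
      filter_upwards [hpA] with l hl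
      simp only [id]
      conv_rhs => rw [← List.map_id l]
      apply List.map_congr_left
      intro y hy
      have := hl y hy
      simp only [evalAt, id]
      rw [if_neg (by omega)]
    rw [Filter.map_congr this, Filter.map_id]
  have hm := uf_map_mul (List.map (evalAt b a)) (fun _ _ => List.map_append)
  apply hmin
  · change A ∈ Ultrafilter.map _ _
    rw [Ultrafilter.mem_map]
    refine Filter.mem_of_superset (f := ((p * e : Ultrafilter (List ℕ)) : Filter (List ℕ))) hqV ?_
    intro l hl
    intro y hy
    rw [List.mem_map] at hy
    obtain ⟨z, hz, rfl⟩ := hy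
    have := hl.1 z hz
    simp only [evalAt]
    split_ifs <;> omega
  · rw [← hm, hqq]
  · have := hm (p * e) p
    rw [hqp, hmap] at this
    exact this.symm
  · have := hm p (p * e)
    rw [hpq, hmap] at this
    exact this.symm

/-- One-dimensional infinite Hales-Jewett type theorem (Carlson-Simpson). -/
theorem ramsey_zero {κ : Type} [Finite κ] (b : ℕ) (c : List ℕ → κ) :
    ∃ w : ℕ → List ℕ, (∀ i, ∀ y ∈ w i, y < b + i) ∧ ∃ κ₀, ∀ a : List ℕ, (∀ y ∈ a, y < b) →
      c (wordMap b w a) = κ₀ := by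
  obtain ⟨p, q, hpp, hpA, hqV, hpq, heval⟩ := exists_pq b
  set pre : List ℕ → List ℕ := fun v => v.takeWhile (fun y => decide (y ≠ b)) with hpre
  obtain ⟨κ₀, hκ₀⟩ := Ultrafilter.eq_pure_of_finite (q.map (fun v => c (pre v).reverse))
  have hB : ∀ᶠ v in (q : Filter (List ℕ)), c (pre v).reverse = κ₀ := by
    have : {κ₀} ∈ q.map (fun v => c (pre v).reverse) := by rw [hκ₀]; simp
    exact this
  set D : Set (List ℕ) := {w | ∀ᶠ v in (q : Filter (List ℕ)), c (w ++ pre v).reverse = κ₀} with hD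
  have hDp : ∀ᶠ w in (p : Filter (List ℕ)), w ∈ D := by
    rw [← hpq, Ultrafilter.eventually_mul] at hB
    filter_upwards [hB, hpA] with w hw hwA
    change ∀ᶠ v in (q : Filter (List ℕ)), _
    filter_upwards [hw] with v hv
    rw [← hv]
    congr 2
    change w ++ pre v = pre (w ++ v)
    simp only [hpre]
    rw [List.takeWhile_append_of_pos]
    intro y hy
    have := hwA y hy
    simp; omega
  set D' : Set (List ℕ) := {w | w ∈ D ∧ ∀ᶠ z in (p : Filter (List ℕ)), w ++ z ∈ D} with hD'
  have hD'p : ∀ᶠ w in (p : Filter (List ℕ)), w ∈ D' := by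
    have h2 := hDp
    rw [← hpp, Ultrafilter.eventually_mul] at h2
    filter_upwards [hDp, h2] with w h1 h2
    exact ⟨h1, h2⟩
  have hD'' : ∀ w ∈ D', ∀ᶠ z in (p : Filter (List ℕ)), w ++ z ∈ D' := by
    rintro w ⟨_, hw⟩
    have h2 := hw
    rw [← hpp, Ultrafilter.eventually_mul] at h2
    filter_upwards [hw, h2] with z h1 h2
    refine ⟨h1, ?_⟩
    filter_upwards [h2] with z' hz'
    rw [List.append_assoc]
    exact hz'
  have step : ∀ E : {E : Finset (List ℕ) // ∀ w ∈ E, w ∈ D'}, ∃ v : List ℕ,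
      ((∀ y ∈ v, y ≤ b) ∧ b ∈ v) ∧ ∀ w ∈ E.1, c (w ++ pre v).reverse = κ₀ ∧
        ∀ a ∈ Finset.range b, w ++ v.map (evalAt b a) ∈ D' := by
    rintro ⟨E, hE⟩
    have h1 : ∀ᶠ v in (q : Filter (List ℕ)), ∀ w ∈ E, c (w ++ pre v).reverse = κ₀ ∧
        ∀ a ∈ Finset.range b, w ++ v.map (evalAt b a) ∈ D' := by
      rw [Filter.eventually_all_finset]
      intro w hw
      apply Filter.Eventually.and (hE w hw).1
      rw [Filter.eventually_all_finset]
      intro a ha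
      have := hD'' w (hE w hw)
      rw [← heval a (Finset.mem_range.1 ha), Ultrafilter.coe_map, Filter.eventually_map] at this
      exact this
    have h2 : ∀ᶠ v in (q : Filter (List ℕ)), v ∈ {l : List ℕ | (∀ y ∈ l, y ≤ b) ∧ b ∈ l} := hqV
    obtain ⟨v, hv1, hv2⟩ := (h1.and h2).exists
    exact ⟨v, hv2, hv1⟩
  choose vv hvv1 hvv2 using step
  obtain ⟨e, heD, heA⟩ := (hD'p.and hpA).exists
  have hstep' : ∀ E : {E : Finset (List ℕ) // ∀ w ∈ E, w ∈ D'}, ∀ w ∈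
      (E.1 ×ˢ Finset.range b).image (fun z => z.1 ++ (vv E).map (evalAt b z.2)), w ∈ D' := by
    intro E w hw
    rw [Finset.mem_image] at hw
    obtain ⟨⟨z, a⟩, hz, rfl⟩ := hw
    rw [Finset.mem_product] at hz
    exact (hvv2 E z hz.1).2 a hz.2
  let st : ℕ → {E : Finset (List ℕ) // ∀ w ∈ E, w ∈ D'} := fun n => Nat.rec
    ⟨{e}, by simpa using heD⟩ (fun _ E => ⟨_, hstep' E⟩) n
  have st_succ : ∀ n, (st (n+1)).1 =
    ((st n).1 ×ˢ Finset.range b).image (fun z => z.1 ++ (vv (st n)).map (evalAt b z.2)) :=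
    fun n => rfl
  let v : ℕ → List ℕ := fun n => vv (st n)
  let tl : ℕ → List ℕ := fun n => ((v n).dropWhile (fun y => decide (y ≠ b))).tail
  have hv : ∀ n, v n = pre (v n) ++ b :: tl n := by
    intro n
    have h1 := List.takeWhile_append_dropWhile (p := fun y => decide (y ≠ b)) (l := v n)
    conv_lhs => rw [← h1]
    congr 1
    have hb : b ∈ v n := (hvv1 (st n)).2
    have hne : (v n).dropWhile (fun y => decide (y ≠ b)) ≠ [] := by
      intro h
      rw [List.dropWhile_eq_nil_iff] at h
      simpa using h b hb
    have h3 := List.head_dropWhile_not (p := fun y => decide (y ≠ b)) (l := v n) hne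
    conv_lhs => rw [← List.cons_head_tail hne]
    congr 1
    simpa using h3
  have hprelt : ∀ n, ∀ y ∈ pre (v n), y < b := by
    intro n y hy
    have h1 := List.mem_takeWhile_imp hy
    have h2 := (hvv1 (st n)).1 y ((List.takeWhile_prefix _).subset hy)
    simp at h1
    omega
  have htl : ∀ n, ∀ y ∈ tl n, y ≤ b := by
    intro n y hy
    apply (hvv1 (st n)).1 y
    change y ∈ v n
    rw [hv n]
    simp [hy]
  let w : ℕ → List ℕ := fun n => Nat.casesOn n (e ++ pre (v 0)).reverse
    (fun n => ((tl n).map (evalAt b (b + n)) ++ pre (v (n+1))).reverse)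
  have hw0 : w 0 = (e ++ pre (v 0)).reverse := rfl
  have hwS : ∀ n, w (n+1) = ((tl n).map (evalAt b (b + n)) ++ pre (v (n+1))).reverse :=
    fun n => rfl
  clear_value w
  refine ⟨w, ?_, κ₀, ?_⟩
  · intro i y hy
    cases i with
    | zero =>
      rw [hw0, List.mem_reverse, List.mem_append] at hy
      rcases hy with h | h
      · exact heA y h
      · exact hprelt 0 y h
    | succ n =>
      rw [hwS, List.mem_reverse, List.mem_append, List.mem_map] at hy
      rcases hy with ⟨z, hz, rfl⟩ | h
      · have := htl n z hz
        simp only [evalAt]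
        split_ifs <;> omega
      · have := hprelt (n+1) y h
        omega
  have main : ∀ a : List ℕ, (∀ y ∈ a, y < b) → ∃ z ∈ (st a.length).1,
      (wordMap b w a).reverse = z ++ pre (v a.length) := by
    intro a
    induction a with
    | nil => intro _; exact ⟨e, by simp [st], by simp [wordMap, hw0]⟩
    | cons x a ih =>
      intro hxa
      obtain ⟨z, hz, hza⟩ := ih (fun y hy => hxa y (by simp [hy]))
      have hx := hxa x (by simp)
      refine ⟨z ++ (v a.length).map (evalAt b x), ?_, ?_⟩
      · rw [List.length_cons, st_succ, Finset.mem_image]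
        exact ⟨(z, x), by simp [hz, hx], rfl⟩
      · have key : (pre (v a.length)).map (evalAt b x) = pre (v a.length) := by
          conv_rhs => rw [← List.map_id (pre (v a.length))]
          apply List.map_congr_left
          intro y hy
          have := hprelt a.length y hy
          simp only [evalAt, id]
          rw [if_neg (by omega)]
        have key2 : (pre (v (a.length+1))).map (wsubst b (x :: a)) = pre (v (a.length+1)) := by
          conv_rhs => rw [← List.map_id (pre (v (a.length+1)))]
          apply List.map_congr_left
          intro y hy
          have := hprelt (a.length+1) y hy
          simp only [wsubst, id]
          rw [if_pos (by omega)]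
        have key3 : ((tl a.length).map (evalAt b (b + a.length))).map (wsubst b (x :: a)) =
            (tl a.length).map (evalAt b x) := by
          rw [List.map_map]
          apply List.map_congr_left
          intro y hy
          have := htl _ y hy
          by_cases hyb : y = b
          · simp [hyb, wsubst, evalAt]
          · have : y < b := by omega
            simp [hyb, wsubst, evalAt, this]
        rw [wordMap, List.reverse_append, List.reverse_cons, hza]
        rw [hwS, List.map_reverse, List.reverse_reverse, List.map_append, key2, key3]
        conv_rhs => rw [hv a.length]
        rw [List.map_append, key, List.map_cons]
        simp [evalAt]
  intro a ha
  obtain ⟨z, hz, hza⟩ := main a ha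
  have := (hvv2 (st a.length) z hz).1
  rw [← List.reverse_reverse (wordMap b w a), hza]
  exact this

end UF

/-! ### Good word maps and the multidimensional theorem -/

structure GoodMap (b : ℕ) (F : List ℕ → List ℕ) : Prop where
  nat : ∀ θ : ℕ → ℕ, (∀ y < b, θ y = y) → ∀ a, F (a.map θ) = (F a).map θ
  ext : ∀ x a, ∃ s, F (x :: a) = s ++ x :: F a

/-- `k`-parameter words over the alphabet `{0, …, b-1}`, with parameters `b, …, b+k-1`. -/
def ParamWord (b : ℕ) : ℕ → List ℕ → Prop
  | 0, u => ∀ y ∈ u, y < b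
  | k + 1, u => ∃ q p, u = q ++ (b + k) :: p ∧ ParamWord b k p ∧ ∀ y ∈ q, y < b + k + 1

theorem goodMap_wordMap {b : ℕ} {w : ℕ → List ℕ} (hw : ∀ i, ∀ y ∈ w i, y < b + i) :
    GoodMap b (wordMap b w) := by
  refine ⟨?_, fun x a => ⟨_, rfl⟩⟩
  intro θ hθ a
  induction a with
  | nil =>
    simp only [List.map_nil, wordMap]
    conv_lhs => rw [← List.map_id (w 0)]
    apply List.map_congr_left
    intro y hy
    have := hw 0 y hy
    exact (hθ y (by omega)).symm
  | cons x a ih =>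
    simp only [List.map_cons, wordMap, List.map_append, List.map_map, ih, List.length_map]
    congr 1
    apply List.map_congr_left
    intro y hy
    have h1 := hw _ y hy
    simp only [Function.comp, wsubst]
    by_cases hyb : y < b
    · simp [hyb, hθ]
    · rw [if_neg hyb, if_neg hyb, ← List.map_cons, ← List.map_reverse]
      have h2 : y - b < (x :: a).reverse.length := by simp; omega
      have h3 : y - b < ((x :: a).reverse.map θ).length := by simp; omega
      rw [List.getD_eq_getElem _ _ h2, List.getD_eq_getElem _ _ h3, List.getElem_map]

namespace GoodMap

theorem id' (b : ℕ) : GoodMap b id := ⟨fun _ _ _ => rfl, fun _ _ => ⟨[], rfl⟩⟩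

variable {b : ℕ} {F G : List ℕ → List ℕ}

theorem ext' (h : GoodMap b F) (q : List ℕ) (x : ℕ) (a : List ℕ) :
    ∃ s, F (q ++ x :: a) = s ++ x :: F a := by
  induction q with
  | nil => exact h.ext x a
  | cons y q ih =>
    obtain ⟨s, hs⟩ := ih
    obtain ⟨t, ht⟩ := h.ext y (q ++ x :: a)
    exact ⟨t ++ y :: s, by rw [List.cons_append, ht, hs]; simp⟩

theorem comp (h : GoodMap b F) (h' : GoodMap b G) : GoodMap b (F ∘ G) := by
  refine ⟨fun θ hθ a => ?_, fun x a => ?_⟩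
  · simp only [Function.comp]
    rw [h'.nat θ hθ, h.nat θ hθ]
  · obtain ⟨s, hs⟩ := h'.ext x a
    simp only [Function.comp]
    rw [hs]
    exact h.ext' s x _

theorem letters (h : GoodMap b F) {a : List ℕ} {y : ℕ} (hy : y ∈ F a) : y < b ∨ y ∈ a := by
  by_contra hcon
  push Not at hcon
  obtain ⟨h1, h2⟩ := hcon
  have h3 : a.map (Function.update id y (y+1)) = a := by
    conv_rhs => rw [← List.map_id a]
    apply List.map_congr_left
    intro z hz
    rw [Function.update_of_ne]
    rintro rfl
    exact h2 hz
  have h4 := h.nat (Function.update id y (y+1)) (fun z hz => by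
    rw [Function.update_of_ne]; rfl; omega) a
  rw [h3] at h4
  rw [h4, List.mem_map] at hy
  obtain ⟨z, _, hz⟩ := hy
  by_cases hzy : z = y
  · subst hzy; simp at hz
  · rw [Function.update_of_ne hzy] at hz
    exact hzy hz

theorem length_eq (h : GoodMap b F) {a a' : List ℕ} (hl : a.length = a'.length) :
    (F a).length = (F a').length := by
  have key : ∀ a : List ℕ, (F a).length =
      (F ((List.range a.length).map (fun i => b + i))).length := by
    intro a
    have := h.nat (fun y => if y < b then y else a.getD (y - b) 0) (fun y hy => by simp [hy])
      ((List.range a.length).map (fun i => b + i))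
    have h2 : ((List.range a.length).map (fun i => b + i)).map
        (fun y => if y < b then y else a.getD (y - b) 0) = a := by
      apply List.ext_getElem
      · simp
      · intro i h1 h2
        simp [h2]
    rw [h2] at this
    conv_lhs => rw [this]
    simp
  rw [key a, key a', hl]

end GoodMap

theorem ParamWord.lt {b k : ℕ} {u : List ℕ} (h : ParamWord b k u) : ∀ y ∈ u, y < b + k := by
  induction k generalizing u with
  | zero => exact h
  | succ k ih =>
    obtain ⟨q, p, rfl, hp, hq⟩ := h
    intro y hy
    simp only [List.mem_append, List.mem_cons] at hy
    rcases hy with h | h | h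
    · have := hq y h; omega
    · omega
    · have := ih hp y h; omega

theorem ParamWord.mem {b k : ℕ} {u : List ℕ} (h : ParamWord b k u) : ∀ i < k, b + i ∈ u := by
  induction k generalizing u with
  | zero => intro i hi; omega
  | succ k ih =>
    obtain ⟨q, p, rfl, hp, hq⟩ := h
    intro i hi
    by_cases hik : i = k
    · subst hik; simp
    · have := ih hp i (by omega)
      simp [this]

theorem GoodMap.paramWord {b : ℕ} {F : List ℕ → List ℕ} (hF : GoodMap b F) {k : ℕ} {u : List ℕ}
    (h : ParamWord b k u) : ParamWord b k (F u) := by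
  induction k generalizing u with
  | zero =>
    intro y hy
    rcases hF.letters hy with h1 | h1
    · exact h1
    · exact h y h1
  | succ k ih =>
    have hlt := h.lt
    obtain ⟨q, p, rfl, hp, hq⟩ := h
    obtain ⟨s, hs⟩ := hF.ext' q (b + k) p
    refine ⟨s, F p, hs, ih hp, ?_⟩
    intro y hy
    have : y ∈ F (q ++ (b + k) :: p) := by rw [hs]; simp [hy]
    rcases hF.letters this with h1 | h1
    · omega
    · have := hlt y h1; omega

theorem shift_formula (b n : ℕ) (w₀ : ℕ → List ℕ) (hw₀ : ∀ i, ∀ y ∈ w₀ i, y < b + n + 1 + i)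
    (wH : ℕ → List ℕ) (hH1 : ∀ i ≤ n, wH i = []) (hH2 : ∀ i, wH (n + 1 + i) = w₀ i) :
    (∀ a : List ℕ, a.length ≤ n → wordMap b wH a = a) ∧
    ∀ a : List ℕ, a.length = n + 1 → ∀ q : List ℕ,
      wordMap b wH (q.map (wsubst b a) ++ a) =
        (wordMap (b + n + 1) w₀ q).map (wsubst b a) ++ a := by
  have H1 : ∀ a : List ℕ, a.length ≤ n → wordMap b wH a = a := by
    intro a
    induction a with
    | nil => intro _; exact hH1 0 (by omega)
    | cons x a ih =>
      intro h
      rw [List.length_cons] at h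
      rw [wordMap, hH1 _ h, ih (by omega)]
      simp
  refine ⟨H1, ?_⟩
  intro a ha q
  induction q with
  | nil =>
    cases a with
    | nil => simp at ha
    | cons x p =>
      rw [List.length_cons] at ha
      have hp : p.length = n := by omega
      simp only [List.map_nil, List.nil_append, wordMap]
      rw [H1 p (by omega), hp, show n + 1 = n + 1 + 0 by rfl, hH2]
  | cons y q ih =>
    simp only [List.map_cons, List.cons_append, wordMap, ih, List.map_append, List.map_map,
      List.append_assoc]
    have : (q.map (wsubst b a) ++ a).length + 1 = n + 1 + (q.length + 1) := by
      simp [ha]; omega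
    rw [this, hH2]
    congr 1
    apply List.map_congr_left
    intro z hz
    have hz' := hw₀ _ z hz
    rw [← List.cons_append, ← List.map_cons]
    have hlen : (y :: q).length = q.length + 1 := rfl
    generalize y :: q = l at *
    simp only [Function.comp]
    unfold wsubst
    by_cases h1 : z < b
    · rw [if_pos h1, if_pos (show z < b + n + 1 by omega), if_pos h1]
    · rw [if_neg h1, List.reverse_append]
      by_cases h2 : z < b + n + 1
      · rw [if_pos h2, if_neg h1, List.getD_append _ _ _ _ (by simp; omega)]
      · rw [if_neg h2, List.getD_append_right _ _ _ _ (by simp; omega), ← List.map_reverse]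
        have h3 : z - (b + n + 1) < l.reverse.length := by simp; omega
        have e1 : z - b - a.reverse.length = z - (b + n + 1) := by simp; omega
        rw [e1, List.getD_eq_getElem (l.reverse) _ h3,
          List.getD_eq_getElem _ _ (by simpa using h3), List.getElem_map]

theorem ramsey_step {κ : Type} [Finite κ] (b k n : ℕ) (c : List ℕ → κ) :
    ∃ H, GoodMap b H ∧ (∀ a : List ℕ, a.length ≤ n → H a = a) ∧
      ∀ p : List ℕ, p.length = n → ParamWord b k p → ∀ q q' : List ℕ,
        (∀ y ∈ q, y < b + k + 1) → (∀ y ∈ q', y < b + k + 1) →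
        c (H (q ++ (b + k) :: p)) = c (H (q' ++ (b + k) :: p)) := by
  let cs : List ℕ → ((Fin n → Fin (b + k)) → κ) := fun q P =>
    c (q.map (wsubst b ((b + k) :: List.ofFn (fun i => (P i : ℕ)))) ++
      (b + k) :: List.ofFn (fun i => (P i : ℕ)))
  obtain ⟨w₀, hw₀, κ₀, hκ₀⟩ := ramsey_zero (b + n + 1) cs
  let wH : ℕ → List ℕ := fun i => if i ≤ n then [] else w₀ (i - (n + 1))
  have hH1 : ∀ i ≤ n, wH i = [] := fun i hi => if_pos hi
  have hH2 : ∀ i, wH (n + 1 + i) = w₀ i := fun i => by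
    simp only [wH]
    rw [if_neg (by omega)]
    congr 1; omega
  obtain ⟨f1, f2⟩ := shift_formula b n w₀ hw₀ wH hH1 hH2
  refine ⟨wordMap b wH, goodMap_wordMap ?_, f1, ?_⟩
  · intro i y hy
    simp only [wH] at hy
    split_ifs at hy with h
    · simp at hy
    · have := hw₀ _ y hy
      omega
  intro p hpn hp
  let P : Fin n → Fin (b + k) := fun i => ⟨p[i], hp.lt _ (List.getElem_mem _)⟩
  have hP : List.ofFn (fun i => (P i : ℕ)) = p := by
    subst hpn
    simp [P]
  have key : ∀ q : List ℕ, (∀ y ∈ q, y < b + k + 1) →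
      c (wordMap b wH (q ++ (b + k) :: p)) = κ₀ P := by
    intro q hq
    have hex : ∀ y : ℕ, ∃ z, z < b + n + 1 ∧
        (y < b + k + 1 → wsubst b ((b + k) :: p) z = y) := by
      intro y
      by_cases hyb : y < b
      · exact ⟨y, by omega, fun _ => by simp [wsubst, hyb]⟩
      by_cases hyk : y < b + k + 1
      · have hmem : y ∈ ((b + k) :: p).reverse := by
          rw [List.mem_reverse, List.mem_cons]
          by_cases h : y = b + k
          · exact Or.inl h
          · right
            have := hp.mem (y - b) (by omega)
            rwa [show b + (y - b) = y by omega] at this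
        obtain ⟨i, hi, hiy⟩ := List.getElem_of_mem hmem
        refine ⟨b + i, ?_, fun _ => ?_⟩
        · simp at hi; omega
        · unfold wsubst
          rw [if_neg (by omega), show b + i - b = i by omega, List.getD_eq_getElem _ _ hi, hiy]
      · exact ⟨0, by omega, fun h => absurd h hyk⟩
    choose z hz1 hz2 using hex
    have hq2 : (q.map z).map (wsubst b ((b + k) :: p)) = q := by
      rw [List.map_map]
      conv_rhs => rw [← List.map_id q]
      apply List.map_congr_left
      intro y hy
      exact hz2 y (hq y hy)
    have h3 := hκ₀ (q.map z) (by
      intro y hy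
      rw [List.mem_map] at hy
      obtain ⟨x, _, rfl⟩ := hy
      exact hz1 x)
    have h4 := congrFun h3 P
    simp only [cs, hP] at h4
    rw [← h4]
    conv_lhs => rw [← hq2]
    rw [f2 _ (by simp [hpn])]
  intro q q' hq hq'
  rw [key q hq, key q' hq']

theorem ramsey_fusion {κ : Type} [Finite κ] (b k : ℕ) (c : List ℕ → κ) :
    ∃ F, GoodMap b F ∧
      ∀ p : List ℕ, ParamWord b k p → ∀ q q' : List ℕ,
        (∀ y ∈ q, y < b + k + 1) → (∀ y ∈ q', y < b + k + 1) →
        c (F (q ++ (b + k) :: p)) = c (F (q' ++ (b + k) :: p)) := by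
  choose H hH1 hH2 hH3 using fun (n : ℕ) (c : List ℕ → κ) => ramsey_step b k n c
  let Fn : ℕ → (List ℕ → List ℕ) := fun n => Nat.rec id (fun n F => F ∘ H n (c ∘ F)) n
  have Fn_succ : ∀ n, Fn (n+1) = Fn n ∘ H n (c ∘ Fn n) := fun n => rfl
  have hFn : ∀ n, GoodMap b (Fn n) := by
    intro n
    induction n with
    | zero => exact GoodMap.id' b
    | succ n ih => rw [Fn_succ]; exact ih.comp (hH1 _ _)
  refine ⟨fun a => Fn a.length a, ⟨?_, ?_⟩, ?_⟩
  · intro θ hθ a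
    simp only [List.length_map]
    exact (hFn _).nat θ hθ a
  · intro x a
    simp only [List.length_cons]
    obtain ⟨s, hs⟩ := (hH1 a.length (c ∘ Fn a.length)).ext x a
    rw [hH2 a.length _ a le_rfl] at hs
    rw [Fn_succ, Function.comp, hs]
    exact (hFn _).ext' s x a
  · intro p hp
    have key2 : ∀ m, p.length + 1 ≤ m → ∀ q : List ℕ, (∀ y ∈ q, y < b + k + 1) →
        ∃ q', (∀ y ∈ q', y < b + k + 1) ∧
          Fn m (q ++ (b + k) :: p) = Fn (p.length + 1) (q' ++ (b + k) :: p) := by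
      intro m hm
      induction m, hm using Nat.le_induction with
      | base => intro q hq; exact ⟨q, hq, rfl⟩
      | succ m hm ih =>
        intro q hq
        obtain ⟨s, hs⟩ := (hH1 m (c ∘ Fn m)).ext' q (b + k) p
        rw [hH2 m _ p (by omega)] at hs
        have hs' : ∀ y ∈ s, y < b + k + 1 := by
          intro y hy
          have h1 : y ∈ H m (c ∘ Fn m) (q ++ (b + k) :: p) := by rw [hs]; simp [hy]
          rcases (hH1 m (c ∘ Fn m)).letters h1 with h | h
          · omega
          · simp only [List.mem_append, List.mem_cons] at h
            rcases h with h | h | h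
            · exact hq y h
            · omega
            · have := hp.lt y h; omega
        obtain ⟨q', h1, h2⟩ := ih s hs'
        refine ⟨q', h1, ?_⟩
        rw [Fn_succ, Function.comp, hs, h2]
    intro q q' hq hq'
    obtain ⟨r, hr, hr2⟩ := key2 (q ++ (b + k) :: p).length (by simp) q hq
    obtain ⟨r', hr', hr2'⟩ := key2 (q' ++ (b + k) :: p).length (by simp) q' hq'
    simp only
    rw [hr2, hr2', Fn_succ]
    exact hH3 p.length (c ∘ Fn p.length) p rfl hp r r' hr hr'

theorem ramsey_params {κ : Type} [Finite κ] (b k : ℕ) (c : List ℕ → κ) :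
    ∃ F, GoodMap b F ∧ ∃ κ₀, ∀ u, ParamWord b k u → c (F u) = κ₀ := by
  induction k generalizing c with
  | zero =>
    obtain ⟨w, hw, κ₀, h⟩ := ramsey_zero b c
    exact ⟨_, goodMap_wordMap hw, κ₀, h⟩
  | succ k ih =>
    obtain ⟨F, hF, hF2⟩ := ramsey_fusion b k c
    obtain ⟨F', hF', κ₀, h⟩ := ih (fun p => c (F ((b + k) :: p)))
    refine ⟨F ∘ F', hF.comp hF', κ₀, ?_⟩
    intro u hu
    have hu2 := (hF'.paramWord hu).lt
    obtain ⟨q, p, rfl, hp, hq⟩ := hu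
    obtain ⟨s, hs⟩ := hF'.ext' q (b + k) p
    rw [hs] at hu2
    rw [← h p hp, Function.comp, hs]
    exact hF2 (F' p) (hF'.paramWord hp) s [] (fun y hy => by
      have := hu2 y (by simp [hy]); omega) (by simp)

/-! ### Envelopes -/

theorem envelope_seq (b : ℕ) {Ty : Type} [DecidableEq Ty] (t : ℕ → Ty) (n : ℕ) :
    ∃ h : List Ty, h.Nodup ∧ (∀ T, T ∈ h ↔ ∃ i < n, t i = T) ∧
      ParamWord b h.length (((List.range n).map (fun i => b + h.idxOf (t i))).reverse) := by
  induction n with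
  | zero => exact ⟨[], by simp, by simp, by simp [ParamWord]⟩
  | succ n ih =>
    obtain ⟨h, hnd, hmem, hpw⟩ := ih
    by_cases ht : t n ∈ h
    · refine ⟨h, hnd, ?_, ?_⟩
      · intro T
        rw [hmem]
        constructor
        · rintro ⟨i, hi, rfl⟩; exact ⟨i, by omega, rfl⟩
        · rintro ⟨i, hi, rfl⟩
          by_cases hin : i = n
          · subst hin; exact (hmem _).1 ht
          · exact ⟨i, by omega, rfl⟩
      · rw [List.range_succ, List.map_append, List.reverse_append]
        have hlt := List.idxOf_lt_length_of_mem ht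
        simp only [List.map_cons, List.map_nil, List.reverse_singleton, List.singleton_append]
        generalize (List.map (fun i => b + List.idxOf (t i) h) (List.range n)).reverse = u at *
        generalize List.idxOf (t n) h = z at *
        generalize h.length = k at *
        cases k with
        | zero => omega
        | succ k =>
          obtain ⟨q, p, rfl, hp, hq⟩ := hpw
          refine ⟨(b + z) :: q, p, rfl, hp, ?_⟩
          intro y hy
          rw [List.mem_cons] at hy
          rcases hy with rfl | hy
          · omega
          · exact hq y hy
    · refine ⟨h ++ [t n], ?_, ?_, ?_⟩
      · rw [List.nodup_append]
        refine ⟨hnd, by simp, ?_⟩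
        intro a ha c hc
        simp at hc
        rintro rfl
        exact ht (hc ▸ ha)
      · intro T
        rw [List.mem_append, hmem, List.mem_singleton]
        constructor
        · rintro (⟨i, hi, rfl⟩ | rfl)
          · exact ⟨i, by omega, rfl⟩
          · exact ⟨n, by omega, rfl⟩
        · rintro ⟨i, hi, rfl⟩
          by_cases hin : i = n
          · subst hin; exact Or.inr rfl
          · exact Or.inl ⟨i, by omega, rfl⟩
      · rw [List.range_succ, List.map_append, List.reverse_append]
        simp only [List.map_cons, List.map_nil, List.reverse_singleton, List.singleton_append,
          List.length_append, List.length_singleton]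
        refine ⟨[], _, ?_, hpw, by simp⟩
        rw [List.nil_append]
        congr 1
        · rw [List.idxOf_append_of_notMem ht]; simp
        · congr 1
          apply List.map_congr_left
          intro i hi
          rw [List.idxOf_append_of_mem]
          exact (hmem _).2 ⟨i, by simpa using hi, rfl⟩

/-- substitution of finitely many parameters. -/
def shapeSubst (b K : ℕ) (a : Fin K → Fin (b + 1)) (y : ℕ) : ℕ :=
  if y < b then y else if h : y - b < K then a ⟨y - b, h⟩ else 0

theorem shapeSubst_add (b K : ℕ) (a : Fin K → Fin (b + 1)) (i : ℕ) (hi : i < K) :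
    shapeSubst b K a (b + i) = a ⟨i, hi⟩ := by
  unfold shapeSubst
  simp [hi]

theorem envelope (b : ℕ) {M : Type} [Finite M] (W : M → List ℕ) (hW : ∀ x, ∀ y ∈ W x, y < b) :
    ∃ u, ParamWord b (Nat.card (M → Fin (b + 1))) u ∧
      ∃ (j : M → Fin (Nat.card (M → Fin (b + 1))))
        (a : M → Fin (Nat.card (M → Fin (b + 1))) → Fin (b + 1)), ∀ x, ∃ s p,
        u = s ++ (b + (j x : ℕ)) :: p ∧ b + (j x : ℕ) ∉ p ∧
          W x = p.map (shapeSubst b _ (a x)) := by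
  classical
  have := Fintype.ofFinite M
  let col : ℕ → (M → Fin (b + 1)) := fun p x =>
    if h : p < (W x).reverse.length then
      ⟨(W x).reverse[p], Nat.lt_succ_of_lt (hW x _ (List.mem_reverse.1 (List.getElem_mem h)))⟩
    else Fin.last b
  obtain ⟨N, hN⟩ : ∃ N, ∀ x, (W x).length ≤ N :=
    ⟨Finset.univ.sup fun x => (W x).length, fun x =>
      Finset.le_sup (f := fun x => (W x).length) (Finset.mem_univ x)⟩
  let e := (Finite.equivFin (M → Fin (b + 1)))
  set K := Nat.card (M → Fin (b + 1)) with hK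
  let t : ℕ → (M → Fin (b + 1)) := fun i =>
    if i ≤ N then col i else if h : i - (N + 1) < K then e.symm ⟨i - (N + 1), h⟩ else col 0
  obtain ⟨h, hnd, hmem, hpw⟩ := envelope_seq b t (N + 1 + K)
  have hall : ∀ T, T ∈ h := by
    intro T
    rw [hmem]
    refine ⟨N + 1 + (e T), by have := (e T).2; omega, ?_⟩
    simp only [t]
    rw [if_neg (by omega), dif_pos (by have := (e T).2; omega)]
    rw [Equiv.symm_apply_eq]
    ext
    simp
  have hlen : h.length = K := by
    rw [← List.toFinset_card_of_nodup hnd, hK, Nat.card_eq_fintype_card, ← Finset.card_univ]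
    congr 1
    ext T
    simp [hall]
  rw [hlen] at hpw
  have hidx : ∀ T, h.idxOf T < K := fun T => by
    rw [← hlen]; exact List.idxOf_lt_length_of_mem (hall T)
  refine ⟨_, hpw, fun x => ⟨h.idxOf (col (W x).length), hidx _⟩,
    fun x i => (h[(i : ℕ)]'(by rw [hlen]; exact i.2)) x, ?_⟩
  intro x
  set ℓ := (W x).length with hℓ
  have hℓN : ℓ ≤ N := hN x
  have tcol : ∀ i ≤ ℓ, t i = col i := fun i hi => if_pos (by omega)
  refine ⟨((List.range' (ℓ+1) (N + K - ℓ)).map (fun i => b + h.idxOf (t i))).reverse,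
    ((List.range ℓ).map (fun i => b + h.idxOf (t i))).reverse, ?_, ?_, ?_⟩
  · have : List.range (N + 1 + K) = List.range ℓ ++ ℓ :: List.range' (ℓ+1) (N + K - ℓ) := by
      rw [← List.range'_succ, List.range_eq_range', List.range_eq_range']
      have := List.range'_append_1 (s := 0) (m := ℓ) (n := N + K - ℓ + 1)
      rw [Nat.zero_add] at this
      rw [this]
      congr 1
      omega
    rw [this, List.map_append, List.reverse_append, List.map_cons, List.reverse_cons,
      List.append_assoc, List.singleton_append, tcol ℓ le_rfl]
  · simp only [List.mem_reverse, List.mem_map, List.mem_range, not_exists, not_and]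
    intro i hi heq
    have h1 : h.idxOf (t i) = h.idxOf (col ℓ) := Nat.add_left_cancel heq
    rw [List.idxOf_inj (hall _), tcol i hi.le] at h1
    have h2 := congrFun h1 x
    simp only [col] at h2
    rw [dif_pos (by simpa using hi), dif_neg (by simp [hℓ])] at h2
    have h3 := congrArg Fin.val h2
    simp only [Fin.val_last] at h3
    have h4 := hW x _ (List.mem_reverse.1 (List.getElem_mem (l := (W x).reverse) (n := i)
      (by simpa using hi)))
    omega
  · rw [List.map_reverse, ← List.reverse_eq_iff, List.map_map]
    apply List.ext_getElem
    · simp [hℓ]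
    · intro i h1 h2
      have hi : i < ℓ := by simpa using h1
      rw [List.getElem_map, List.getElem_range]
      rw [Function.comp, shapeSubst_add _ _ _ _ (hidx (t i))]
      beta_reduce
      simp only [List.getElem_idxOf]
      rw [tcol i hi.le]
      simp only [col]
      rw [dif_pos]

def trunc (j : ℕ) (u : List ℕ) : List ℕ := u.rtakeWhile (fun y => decide (y ≠ j))

theorem trunc_eq {j : ℕ} {s p : List ℕ} (h : j ∉ p) : trunc j (s ++ j :: p) = p := by
  unfold trunc List.rtakeWhile
  rw [List.reverse_append, List.reverse_cons, List.append_assoc, List.takeWhile_append_of_pos]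
  · simp
  · intro y hy
    simp only [ne_eq, decide_eq_true_eq]
    rintro rfl
    exact h (List.mem_reverse.1 hy)

/-! ### Compact distance sets -/

/-- nonzero elements of `S` in the same block. -/
def NB (S : Finset ℝ) (x y : ℝ) : Prop :=
  x ∈ S ∧ y ∈ S ∧ x ≠ 0 ∧ y ≠ 0 ∧ ∀ j, JumpNumber S j → (x ≤ j ↔ y ≤ j)

theorem NB.symm {S : Finset ℝ} {x y : ℝ} (h : NB S x y) : NB S y x :=
  ⟨h.2.1, h.1, h.2.2.2.1, h.2.2.1, fun j hj => (h.2.2.2.2 j hj).symm⟩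

theorem NB.trans {S : Finset ℝ} {x y z : ℝ} (h : NB S x y) (h' : NB S y z) : NB S x z :=
  ⟨h.1, h'.2.1, h.2.2.1, h'.2.2.2.1, fun j hj => (h.2.2.2.2 j hj).trans (h'.2.2.2.2 j hj)⟩

theorem NB.refl' {S : Finset ℝ} {x : ℝ} (h : x ∈ S) (h' : x ≠ 0) : NB S x x :=
  ⟨h, h, h', h', fun _ _ => Iff.rfl⟩

theorem nb_iff {S : Finset ℝ} {x y : ℝ} (hy : y ≠ 0) : SameBlock S x y ↔ NB S x y := by
  unfold SameBlock NB
  constructor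
  · rintro ⟨hx, hy', h⟩
    rcases h with h | ⟨h1, h2, h3⟩
    · exact absurd h.2 hy
    · refine ⟨hx, hy', h1, h2, fun j hj => ?_⟩
      have := h3 j hj
      by_contra hcon
      apply this
      rw [min_le_iff, lt_max_iff]
      by_cases hxj : x ≤ j <;> by_cases hyj : y ≤ j
      · exact absurd (iff_of_true hxj hyj) hcon
      · exact ⟨Or.inl hxj, Or.inr (not_le.1 hyj)⟩
      · exact ⟨Or.inr hyj, Or.inl (not_le.1 hxj)⟩
      · exact absurd (iff_of_false hxj hyj) hcon
  · rintro ⟨hx, hy', h1, h2, h3⟩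
    refine ⟨hx, hy', Or.inr ⟨h1, h2, fun j hj => ?_⟩⟩
    rintro ⟨h4, h5⟩
    rw [min_le_iff] at h4
    rw [lt_max_iff] at h5
    have := h3 j hj
    rcases h4 with h4 | h4 <;> rcases h5 with h5 | h5
    · linarith
    · have := this.1 h4; linarith
    · have := this.2 h4; linarith
    · linarith

structure SHyp (S : Finset ℝ) (s1 : ℝ) : Prop where
  h0 : (0 : ℝ) ∈ S
  hnn : ∀ s ∈ S, 0 ≤ s
  hs1S : s1 ∈ S
  hs1pos : 0 < s1
  hs1min : ∀ s ∈ S, s ≠ 0 → s1 ≤ s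
  hcds : CompactDistanceSet S s1

theorem jump_closed {S : Finset ℝ} {j x y z : ℝ} (hj : JumpNumber S j) (hx : x ≤ j) (hy : y ≤ j)
    (hz : z ∈ S) (h : z ≤ x + y) : z ≤ j := by
  by_contra hcon
  have := hj.2 z hz (not_le.1 hcon)
  linarith

namespace SHyp
variable {S : Finset ℝ} {s1 : ℝ}

theorem low (H : SHyp S s1) {d : ℝ} : InLowBlock S s1 d ↔ d = 0 ∨ NB S d s1 := by
  unfold InLowBlock
  rw [nb_iff H.hs1pos.ne']

theorem close (H : SHyp S s1) {x y : ℝ} (h : NB S x y) : |x - y| ≤ s1 :=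
  (H.hcds x h.1 y h.2.1 h.2.2.1 h.2.2.2.1).2 ((nb_iff h.2.2.2.1).2 h)

theorem tri (H : SHyp S s1) {a b c α β γ : ℝ} (ha : NB S a α) (hb : NB S b β) (hc : NB S c γ)
    (h : NB S α β ∨ NB S α γ ∨ NB S α s1 ∨ α ≤ β + γ) : a ≤ b + c := by
  have hb1 := H.hs1min b hb.1 hb.2.2.1
  have hc1 := H.hs1min c hc.1 hc.2.2.1
  have c1 : NB S α β → a ≤ b + c := fun h => by
    have := H.close ((ha.trans h).trans hb.symm)
    have := (abs_le.1 this).2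
    linarith
  have c2 : NB S α γ → a ≤ b + c := fun h => by
    have := H.close ((ha.trans h).trans hc.symm)
    have := (abs_le.1 this).2
    linarith
  rcases h with h | h | h | h
  · exact c1 h
  · exact c2 h
  · have := H.close (ha.trans h)
    have := (abs_le.1 this).2
    linarith
  · by_cases h1 : NB S α β
    · exact c1 h1
    by_cases h2 : NB S α γ
    · exact c2 h2
    have e1 : ∃ j, JumpNumber S j ∧ ¬ (α ≤ j ↔ β ≤ j) := by
      by_contra hcon
      push Not at hcon
      exact h1 ⟨ha.2.1, hb.2.1, ha.2.2.2.1, hb.2.2.2.1, hcon⟩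
    have e2 : ∃ j, JumpNumber S j ∧ ¬ (α ≤ j ↔ γ ≤ j) := by
      by_contra hcon
      push Not at hcon
      exact h2 ⟨ha.2.1, hc.2.1, ha.2.2.2.1, hc.2.2.2.1, hcon⟩
    obtain ⟨j, hj, hj'⟩ := e1
    obtain ⟨i, hi, hi'⟩ := e2
    have aj := ha.2.2.2.2 j hj
    have bj := hb.2.2.2.2 j hj
    have ai := ha.2.2.2.2 i hi
    have ci := hc.2.2.2.2 i hi
    by_cases hαj : α ≤ j
    · have : ¬ β ≤ j := fun h => hj' (iff_of_true hαj h)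
      have h3 : ¬ b ≤ j := fun h => this (bj.1 h)
      have h4 := aj.2 hαj
      have := H.hs1pos
      linarith
    by_cases hαi : α ≤ i
    · have : ¬ γ ≤ i := fun h => hi' (iff_of_true hαi h)
      have h3 : ¬ c ≤ i := fun h => this (ci.1 h)
      have h4 := ai.2 hαi
      have := H.hs1pos
      linarith
    have hβ : β ≤ j := by
      by_contra hh; exact hj' (iff_of_false hαj hh)
    have hγ : γ ≤ i := by
      by_contra hh; exact hi' (iff_of_false hαi hh)
    exfalso
    rcases le_total i j with hij | hij
    · exact hαj (jump_closed hj hβ (hγ.trans hij) ha.2.1 h)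
    · exact hαi (jump_closed hi (hβ.trans hij) hγ ha.2.1 h)

end SHyp

open Classical in
/-- the representative of the palette between two parts -/
noncomputable def del {L : Type} [MetricSpace L] (s1 : ℝ) (x y : L) : ℝ :=
  if x = y then s1 else dist x y

section
variable {S : Finset ℝ} {s1 : ℝ} {L : Type} [MetricSpace L]

theorem del_comm (x y : L) : del s1 x y = del s1 y x := by
  unfold del
  by_cases h : x = y
  · subst h; rfl
  · rw [if_neg h, if_neg (Ne.symm h), dist_comm]

theorem del_nb (H : SHyp S s1) (hLS : ∀ x y : L, dist x y ∈ S) (x y : L) :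
    NB S (del s1 x y) (del s1 x y) := by
  unfold del
  split_ifs with h
  · exact NB.refl' H.hs1S H.hs1pos.ne'
  · exact NB.refl' (hLS _ _) (dist_ne_zero.2 h)

theorem del_tri (H : SHyp S s1) (hLS : ∀ x y : L, dist x y ∈ S) (x y z : L) :
    NB S (del s1 x z) (del s1 x y) ∨ NB S (del s1 x z) (del s1 y z) ∨ NB S (del s1 x z) s1 ∨
      del s1 x z ≤ del s1 x y + del s1 y z := by
  by_cases h1 : x = y
  · subst h1; exact Or.inr (Or.inl (del_nb H hLS _ _))
  by_cases h2 : y = z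
  · subst h2; exact Or.inl (del_nb H hLS _ _)
  by_cases h3 : x = z
  · subst h3
    right; right; left
    have := del_nb H hLS x x
    simpa [del] using this
  · right; right; right
    simp only [del, if_neg h1, if_neg h2, if_neg h3]
    exact dist_triangle x y z

theorem part_nb (H : SHyp S s1) (hLS : ∀ x y : L, dist x y ∈ S) {U : Type} [MetricSpace U]
    (hUS : ∀ x y : U, dist x y ∈ S) {τ : L → U} (hτ : Isometry τ) {P : U → L}
    (hP : ∀ m, InLowBlock S s1 (dist m (τ (P m)))) {x y : U} (hxy : x ≠ y) :
    NB S (dist x y) (del s1 (P x) (P y)) := by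
  have hd := del_nb H hLS (P x) (P y)
  have hd0 : dist x y ≠ 0 := dist_ne_zero.2 hxy
  refine ⟨hUS _ _, hd.1, hd0, hd.2.2.1, fun j hj => ?_⟩
  have hs1 := H.hs1min _ (hUS x y) hd0
  have lowj : s1 ≤ j → ∀ m, dist m (τ (P m)) ≤ j := by
    intro h m
    rcases (H.low).1 (hP m) with h1 | h1
    · rw [h1]; exact H.hs1pos.le.trans h
    · exact (h1.2.2.2.2 j hj).2 h
  unfold del
  by_cases hPxy : P x = P y
  · rw [if_pos hPxy]
    refine ⟨fun h => hs1.trans h, fun h => ?_⟩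
    apply jump_closed hj (lowj h x) (lowj h y) (hUS _ _)
    rw [hPxy]
    exact dist_triangle_right x y _
  · rw [if_neg hPxy]
    have hs1' := H.hs1min _ (hLS (P x) (P y)) (dist_ne_zero.2 hPxy)
    rw [← hτ.dist_eq] at hs1' ⊢
    constructor
    · intro h
      have h1 := lowj (hs1.trans h)
      have h2 : dist (τ (P x)) y ≤ j := jump_closed hj (h1 x) h (hUS _ _) (by
        rw [dist_comm x]; exact dist_triangle _ _ _)
      exact jump_closed hj h2 (h1 y) (hUS _ _) (dist_triangle _ _ _)
    · intro h
      have h1 := lowj (hs1'.trans h)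
      have h2 : dist x (τ (P y)) ≤ j := jump_closed hj (h1 x) h (hUS _ _) (dist_triangle _ _ _)
      exact jump_closed hj h2 (h1 y) (hUS _ _) (dist_triangle_right _ _ _)

end

def optDist {X : Type} [MetricSpace X] (g : X → ℝ) : Option X → Option X → ℝ
  | none, none => 0
  | none, some x => g x
  | some x, none => g x
  | some x, some y => dist x y

@[reducible] noncomputable def optMetric {X : Type} [MetricSpace X] (g : X → ℝ) (h0 : ∀ x, 0 < g x)
    (h1 : ∀ x y, g x ≤ g y + dist y x) (h2 : ∀ x y, dist x y ≤ g x + g y) :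
    MetricSpace (Option X) where
  dist := optDist g
  dist_self := by rintro (_ | x) <;> simp [optDist]
  dist_comm := by rintro (_ | x) (_ | y) <;> simp [optDist, dist_comm]
  dist_triangle := by
    rintro (_ | x) (_ | y) (_ | z) <;> simp only [optDist]
    · simp
    · simp
    · linarith [h0 y]
    · exact h1 z y
    · simp
    · exact h2 x z
    · have := h1 x y
      rw [dist_comm] at this
      linarith
    · exact dist_triangle _ _ _
  eq_of_dist_eq_zero := by
    rintro (_ | x) (_ | y) h
    · rfl
    · exact absurd h (h0 y).ne'
    · exact absurd h (h0 x).ne'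
    · rw [eq_of_dist_eq_zero (x := x) (y := y) h]

theorem ext_prop {S : Finset ℝ} {s1 : ℝ} (H : SHyp S s1)
    (L : Type) [MetricSpace L] (hLfin : Finite L)
    (hLS : ∀ x y : L, dist x y ∈ S)
    (hLplus : ∀ x y : L, dist x y = 0 ∨ ¬ SameBlock S (dist x y) s1)
    (U : Type) [MetricSpace U]
    (hUS : ∀ x y : U, dist x y ∈ S)
    (huniv : ∀ (A : Type) [MetricSpace A], Finite A →
      (∀ x y : A, dist x y ∈ S) → Spans S s1 L A → ∃ f : A → U, Isometry f)
    (hultra : ∀ (A : Type) [MetricSpace A], Finite A →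
      (∀ x y : A, dist x y ∈ S) → Spans S s1 L A →
      ∀ (f g : A → U), Isometry f → Isometry g →
        ∃ h : U → U, Isometry h ∧ Function.Surjective h ∧ ∀ a : A, f a = h (g a))
    (τ : L → U) (hτ : Isometry τ) (P : U → L)
    (hP : ∀ m, InLowBlock S s1 (dist m (τ (P m))))
    (hPu : ∀ m a, InLowBlock S s1 (dist m (τ a)) → a = P m)
    (F : Finset U) (ℓ : L) (g : U → ℝ) (hg : ∀ f ∈ F, NB S (g f) (del s1 ℓ (P f))) :
    ∃ u, P u = ℓ ∧ ∀ f ∈ F, dist u f = g f := by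
  classical
  let X : Set U := (F : Set U) ∪ Set.range τ
  have hXfin : Finite X := ((Finset.finite_toSet F).union (Set.finite_range τ)).to_subtype
  let g' : X → ℝ := fun x => if x.1 ∈ F then g x.1 else del s1 ℓ (P x.1)
  have hg' : ∀ x : X, NB S (g' x) (del s1 ℓ (P x.1)) := by
    intro x
    simp only [g']
    split_ifs with h
    · exact hg _ h
    · exact del_nb H hLS _ _
  have hPτ : ∀ a, P (τ a) = a := fun a => (hPu (τ a) a (Or.inl (dist_self _))).symm
  have nbU : ∀ {x y : U}, x ≠ y → NB S (dist x y) (del s1 (P x) (P y)) := fun h =>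
    part_nb H hLS hUS hτ hP h
  have hpos : ∀ x, 0 < g' x := fun x =>
    lt_of_le_of_ne (H.hnn _ (hg' x).1) (hg' x).2.2.1.symm
  have h1 : ∀ x y : X, g' x ≤ g' y + dist y x := by
    intro x y
    by_cases hxy : y = x
    · subst hxy; simp
    · have hne : y.1 ≠ x.1 := fun h => hxy (Subtype.ext h)
      exact H.tri (hg' x) (hg' y) (nbU hne) (del_tri H hLS _ _ _)
  have h2 : ∀ x y : X, dist x y ≤ g' x + g' y := by
    intro x y
    by_cases hxy : x = y
    · subst hxy; simp; linarith [hpos x]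
    · have hne : x.1 ≠ y.1 := fun h => hxy (Subtype.ext h)
      have e1 := hg' x
      rw [del_comm] at e1
      exact H.tri (nbU hne) e1 (hg' y) (del_tri H hLS _ _ _)
  have hXsp : Spans S s1 L X := by
    refine ⟨fun a => ⟨τ a, Or.inr ⟨a, rfl⟩⟩, Isometry.of_dist_eq fun x y => hτ.dist_eq x y, ?_⟩
    intro m
    exact ⟨P m.1, hP m.1, fun a ha => hPu _ _ ha⟩
  letI := optMetric g' hpos h1 h2
  have hAS : ∀ x y : Option X, dist x y ∈ S := by
    rintro (_ | x) (_ | y)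
    · exact H.h0
    · exact (hg' y).1
    · exact (hg' x).1
    · exact hUS _ _
  have hAsp : Spans S s1 L (Option X) := by
    refine ⟨fun a => some ⟨τ a, Or.inr ⟨a, rfl⟩⟩, Isometry.of_dist_eq fun x y => hτ.dist_eq x y, ?_⟩
    rintro (_ | m)
    · have key : ∀ a, InLowBlock S s1 (g' ⟨τ a, Or.inr ⟨a, rfl⟩⟩) ↔ a = ℓ := by
        intro a
        have e := hg' ⟨τ a, Or.inr ⟨a, rfl⟩⟩
        simp only [hPτ] at e
        rw [H.low]
        constructor
        · rintro (h | h)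
          · exact absurd h e.2.2.1
          · by_contra hne
            have e2 := e.symm.trans h
            simp only [del, if_neg (Ne.symm hne)] at e2
            rcases hLplus ℓ a with h3 | h3
            · exact hne (dist_eq_zero.1 h3).symm
            · exact h3 ((nb_iff H.hs1pos.ne').2 e2)
        · rintro rfl
          right
          simpa [del] using e
      exact ⟨ℓ, (key ℓ).2 rfl, fun a ha => (key a).1 ha⟩
    · exact ⟨P m.1, hP m.1, fun a ha => hPu _ _ ha⟩
  obtain ⟨f, hf⟩ := huniv (Option X) inferInstance hAS hAsp
  obtain ⟨h, hh, -, hfh⟩ := hultra X hXfin (fun x y => hUS _ _) hXsp (fun x => x.1)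
    (fun x => f (some x)) isometry_subtype_coe
    (Isometry.of_dist_eq fun x y => hf.dist_eq (some x) (some y))
  have key : ∀ x : X, dist (h (f none)) x.1 = g' x := by
    intro x
    rw [show x.1 = h (f (some x)) from hfh x, hh.dist_eq, hf.dist_eq]
    rfl
  refine ⟨h (f none), ?_, ?_⟩
  · symm
    apply hPu
    have e := key ⟨τ ℓ, Or.inr ⟨ℓ, rfl⟩⟩
    simp only at e
    rw [e, H.low]
    right
    have e2 := hg' ⟨τ ℓ, Or.inr ⟨ℓ, rfl⟩⟩
    simpa [del, hPτ] using e2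
  · intro x hx
    have e := key ⟨x, Or.inl hx⟩
    rw [e]
    simp only [g']
    rw [if_pos hx]

/-! ### Realizing the tree metric, and the final coloring argument -/

theorem exists_seq {U : Type} [Nonempty U] (Q : ℕ → U → Prop) (R : ℕ → ℕ → U → U → Prop)
    (step : ∀ (n : ℕ) (f : ℕ → U), (∀ i < n, Q i (f i)) →
      (∀ i < n, ∀ j < i, R j i (f j) (f i)) → ∃ u, Q n u ∧ ∀ j < n, R j n (f j) u) :
    ∃ f : ℕ → U, (∀ n, Q n (f n)) ∧ ∀ n, ∀ j < n, R j n (f j) (f n) := by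
  classical
  have step' : ∀ (n : ℕ) (f : ℕ → U), ∃ u, (∀ i < n, Q i (f i)) →
      (∀ i < n, ∀ j < i, R j i (f j) (f i)) → Q n u ∧ ∀ j < n, R j n (f j) u := by
    intro n f
    by_cases h : (∀ i < n, Q i (f i)) ∧ (∀ i < n, ∀ j < i, R j i (f j) (f i))
    · obtain ⟨u, hu⟩ := step n f h.1 h.2
      exact ⟨u, fun _ _ => hu⟩
    · exact ⟨Classical.arbitrary U, fun h1 h2 => absurd ⟨h1, h2⟩ h⟩
  choose nx hnx using step'
  let st : ℕ → (ℕ → U) := fun n => Nat.rec (fun _ => Classical.arbitrary U)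
    (fun n f => Function.update f n (nx n f)) n
  have hst : ∀ n, st (n + 1) = Function.update (st n) n (nx n (st n)) := fun n => rfl
  let f : ℕ → U := fun n => nx n (st n)
  have agree : ∀ n, ∀ i < n, st n i = f i := by
    intro n
    induction n with
    | zero => intro i hi; omega
    | succ n ih =>
      intro i hi
      rw [hst]
      by_cases h : i = n
      · subst h; simp [f]
      · rw [Function.update_of_ne h, ih i (by omega)]
  have key : ∀ n, Q n (f n) ∧ ∀ j < n, R j n (f j) (f n) := by
    intro n
    induction n using Nat.strong_induction_on with
    | _ n ih =>
      have := hnx n (st n)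
        (fun i hi => by rw [agree n i hi]; exact (ih i hi).1)
        (fun i hi j hj => by
          rw [agree n i hi, agree n j (by omega)]; exact (ih i hi).2 j hj)
      refine ⟨this.1, fun j hj => ?_⟩
      have h2 := this.2 j hj
      rwa [agree n j hj] at h2
  exact ⟨f, fun n => (key n).1, fun n => (key n).2⟩

theorem realize {S : Finset ℝ} {s1 : ℝ} {L : Type} [MetricSpace L] {U : Type} [MetricSpace U]
    [Nonempty U] (P : U → L)
    (hext : ∀ (F : Finset U) (ℓ : L) (g : U → ℝ), (∀ f ∈ F, NB S (g f) (del s1 ℓ (P f))) →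
      ∃ u, P u = ℓ ∧ ∀ f ∈ F, dist u f = g f)
    (d : ℕ → ℕ → ℝ) (lam : ℕ → L) (hd : ∀ i j, NB S (d i j) (del s1 (lam i) (lam j))) :
    ∃ f : ℕ → U, (∀ n, P (f n) = lam n) ∧ ∀ n, ∀ j < n, dist (f n) (f j) = d n j := by
  classical
  refine exists_seq (fun n u => P u = lam n) (fun j n v u => dist u v = d n j) ?_
  intro n f hQ hR
  have hinj : Set.InjOn f (Set.Iio n) := by
    have aux : ∀ i < n, ∀ j < i, f i ≠ f j := by
      intro i hi j hj he
      have := hR i hi j hj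
      rw [he, dist_self] at this
      exact (hd i j).2.2.1 this.symm
    intro i hi j hj he
    rcases lt_trichotomy i j with h | h | h
    · exact absurd he.symm (aux j hj i h)
    · exact h
    · exact absurd he (aux i hi j h)
  have hinv : ∀ j < n, Function.invFunOn f (Set.Iio n) (f j) = j :=
    fun j hj => hinj.leftInvOn_invFunOn hj
  obtain ⟨u, hu, hu'⟩ := hext ((Finset.range n).image f) (lam n)
    (fun v => d n (Function.invFunOn f (Set.Iio n) v)) (by
      intro v hv
      obtain ⟨j, hj, rfl⟩ := Finset.mem_image.1 hv
      have hj' := Finset.mem_range.1 hj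
      simp only [hinv j hj', hQ j hj']
      exact hd n j)
  refine ⟨u, hu, fun j hj => ?_⟩
  have := hu' (f j) (Finset.mem_image_of_mem f (Finset.mem_range.2 hj))
  simpa only [hinv j hj] using this

open Classical in
/-- distance decoded from a letter, corrected to be in the right block -/
noncomputable def letterVal (S : Finset ℝ) (s1 : ℝ) (dec : ℕ → ℝ) {L : Type} [MetricSpace L]
    (ℓ ℓ' : L) (y : ℕ) : ℝ :=
  if NB S (dec y) (del s1 ℓ ℓ') then dec y else del s1 ℓ ℓ'

/-- distance on the tree of labelled words -/
noncomputable def treeDist (S : Finset ℝ) (s1 : ℝ) (dec : ℕ → ℝ) {L : Type} [MetricSpace L]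
    (g g' : L × List ℕ) : ℝ :=
  if g.2.length < g'.2.length then letterVal S s1 dec g.1 g'.1 (g'.2.reverse.getD g.2.length 0)
  else if g'.2.length < g.2.length then
    letterVal S s1 dec g.1 g'.1 (g.2.reverse.getD g'.2.length 0)
  else del s1 g.1 g'.1

section
variable {S : Finset ℝ} {s1 : ℝ} {L : Type} [MetricSpace L]

theorem letterVal_nb (H : SHyp S s1) (hLS : ∀ x y : L, dist x y ∈ S) (dec : ℕ → ℝ) (ℓ ℓ' : L)
    (y : ℕ) : NB S (letterVal S s1 dec ℓ ℓ' y) (del s1 ℓ ℓ') := by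
  unfold letterVal
  split_ifs with h
  · exact h
  · exact del_nb H hLS _ _

theorem letterVal_comm (dec : ℕ → ℝ) (ℓ ℓ' : L) (y : ℕ) :
    letterVal S s1 dec ℓ ℓ' y = letterVal S s1 dec ℓ' ℓ y := by
  unfold letterVal
  rw [del_comm]

theorem treeDist_nb (H : SHyp S s1) (hLS : ∀ x y : L, dist x y ∈ S) (dec : ℕ → ℝ)
    (g g' : L × List ℕ) : NB S (treeDist S s1 dec g g') (del s1 g.1 g'.1) := by
  unfold treeDist
  split_ifs
  · exact letterVal_nb H hLS _ _ _ _
  · exact letterVal_nb H hLS _ _ _ _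
  · exact del_nb H hLS _ _

theorem treeDist_comm (dec : ℕ → ℝ) (g g' : L × List ℕ) :
    treeDist S s1 dec g g' = treeDist S s1 dec g' g := by
  unfold treeDist
  split_ifs with h1 h2 h2
  · omega
  · exact letterVal_comm _ _ _ _
  · exact letterVal_comm _ _ _ _
  · exact del_comm _ _

theorem treeDist_cons (dec : ℕ → ℝ) (ℓ ℓ' : L) (p q s : List ℕ) (x : ℕ)
    (hl : q.length = p.length) :
    treeDist S s1 dec (ℓ, q) (ℓ', s ++ x :: p) = letterVal S s1 dec ℓ ℓ' x := by
  unfold treeDist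
  rw [if_pos (by simp; omega)]
  congr 1
  simp [List.getD_eq_getElem?_getD, hl]

theorem exists_tree (H : SHyp S s1) [Finite L] (hLS : ∀ x y : L, dist x y ∈ S) (dec : ℕ → ℝ)
    {U : Type} [MetricSpace U] [Nonempty U] (P : U → L)
    (hext : ∀ (F : Finset U) (ℓ : L) (g : U → ℝ), (∀ f ∈ F, NB S (g f) (del s1 ℓ (P f))) →
      ∃ u, P u = ℓ ∧ ∀ f ∈ F, dist u f = g f) :
    ∃ r : L × List ℕ → U, ∀ g g', g ≠ g' → dist (r g) (r g') = treeDist S s1 dec g g' := by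
  have : Nonempty L := ⟨P (Classical.arbitrary U)⟩
  obtain ⟨e⟩ := nonempty_equiv_of_countable (α := L × List ℕ) (β := ℕ)
  obtain ⟨f, -, hf⟩ := realize P hext (fun i j => treeDist S s1 dec (e.symm i) (e.symm j))
    (fun i => (e.symm i).1) (fun i j => treeDist_nb H hLS dec _ _)
  refine ⟨fun g => f (e g), fun g g' hne => ?_⟩
  rcases lt_trichotomy (e g) (e g') with h | h | h
  · rw [dist_comm, hf _ _ h, treeDist_comm]; simp
  · exact absurd (e.injective h) hne
  · rw [hf _ _ h]; simp

end

theorem exists_enc (S : Finset ℝ) : ∃ (enc : ℝ → ℕ) (dec : ℕ → ℝ),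
    ∀ s ∈ S, enc s < S.card ∧ dec (enc s) = s := by
  classical
  refine ⟨fun s => if h : s ∈ S then S.equivFin ⟨s, h⟩ else 0,
    fun n => if h : n < S.card then S.equivFin.symm ⟨n, h⟩ else 0, fun s hs => ?_⟩
  simp [hs]

/-- the word of a point with respect to an enumeration -/
noncomputable def ptWord {U : Type} [MetricSpace U] (eU : U ≃ ℕ) (enc : ℝ → ℕ) (u : U) : List ℕ :=
  ((List.range (eU u)).map (fun j => enc (dist u (eU.symm j)))).reverse

theorem ptWord_lt {U : Type} [MetricSpace U] (eU : U ≃ ℕ) (enc : ℝ → ℕ) {u v : U}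
    (h : eU u < eU v) : ∃ q p, ptWord eU enc v = q ++ enc (dist v u) :: p ∧
      p.length = (ptWord eU enc u).length := by
  obtain ⟨m, hm⟩ := Nat.exists_eq_add_of_lt h
  refine ⟨((List.range m).map (fun i => enc (dist v (eU.symm (eU u + 1 + i))))).reverse,
    ((List.range (eU u)).map (fun j => enc (dist v (eU.symm j)))).reverse, ?_, ?_⟩
  · unfold ptWord
    rw [hm, show eU u + m + 1 = eU u + 1 + m by omega, List.range_add, List.range_succ]
    simp [Function.comp_def]
  · simp [ptWord]

theorem main_coloring {S : Finset ℝ} {s1 : ℝ} (H : SHyp S s1)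
    {L : Type} [MetricSpace L] [Finite L] (hLS : ∀ x y : L, dist x y ∈ S)
    {U : Type} [MetricSpace U] [Countable U] [Infinite U]
    (hUS : ∀ x y : U, dist x y ∈ S) (P : U → L)
    (hpart : ∀ x y : U, x ≠ y → NB S (dist x y) (del s1 (P x) (P y)))
    (hext : ∀ (F : Finset U) (ℓ : L) (g : U → ℝ), (∀ f ∈ F, NB S (g f) (del s1 ℓ (P f))) →
      ∃ u, P u = ℓ ∧ ∀ f ∈ F, dist u f = g f)
    (M : Type) [MetricSpace M] [Finite M] :
    ∃ T : ℕ, 0 < T ∧ ∀ k, 2 ≤ k →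
      ∀ χ : {f : M → U // Isometry f} → Fin k,
        ∃ w : {g : U → U // Isometry g},
          (χ '' {p | ∃ f₀ : {f : M → U // Isometry f},
            p.val = w.val ∘ f₀.val}).ncard ≤ T := by
  classical
  obtain ⟨enc, dec, hed⟩ := exists_enc S
  obtain ⟨r, hr⟩ := exists_tree H hLS dec P hext
  obtain ⟨eU⟩ := nonempty_equiv_of_countable (α := U) (β := ℕ)
  set b := S.card with hb
  let W := ptWord eU enc
  have hW : ∀ u, ∀ y ∈ W u, y < b := by
    intro u y hy
    simp only [W, ptWord, List.mem_reverse, List.mem_map] at hy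
    obtain ⟨j, -, rfl⟩ := hy
    exact (hed _ (hUS _ _)).1
  have hiso : ∀ F, GoodMap b F → Isometry (fun u => r (P u, F (W u))) := by
    intro F hF
    have key : ∀ u v, eU u < eU v →
        dist (r (P u, F (W u))) (r (P v, F (W v))) = dist u v := by
      intro u v huv
      obtain ⟨q, p, hv, hp⟩ := ptWord_lt eU enc huv
      obtain ⟨s, hs⟩ := hF.ext' q (enc (dist v u)) p
      have hlen := hF.length_eq hp
      have e : F (W v) = s ++ enc (dist v u) :: F p := by
        rw [← hs, ← hv]
      rw [hr _ _ ?_, e, treeDist_cons dec _ _ _ _ _ _ hlen.symm]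
      · have hne : u ≠ v := by rintro rfl; omega
        have h2 := (hed _ (hUS v u)).2
        unfold letterVal
        rw [h2, dist_comm v u, if_pos (hpart u v hne)]
      · intro he
        have h2 := congrArg (fun g : L × List ℕ => g.2.length) he
        simp only [e, List.length_append, List.length_cons] at h2
        have h3 : (F (W u)).length = (F p).length := hlen.symm
        omega
    refine Isometry.of_dist_eq fun u v => ?_
    rcases lt_trichotomy (eU u) (eU v) with h | h | h
    · exact key u v h
    · rw [eU.injective h]; simp
    · rw [dist_comm, key v u h, dist_comm]
  let K := Nat.card (M → Fin (b + 1))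
  let Shape := M → L × Fin K × (Fin K → Fin (b + 1))
  have : Finite Shape := inferInstanceAs (Finite (M → L × Fin K × (Fin K → Fin (b + 1))))
  refine ⟨Nat.card Shape + 1, by omega, fun k hk χ => ?_⟩
  let Φ : Shape → List ℕ → M → U := fun sh v x =>
    r ((sh x).1, (trunc (b + ((sh x).2.1 : ℕ)) v).map (shapeSubst b K (sh x).2.2))
  let c : List ℕ → (Shape → Fin k) := fun v sh =>
    if h : Isometry (Φ sh v) then χ ⟨_, h⟩ else ⟨0, by omega⟩
  obtain ⟨F, hF, κ₀, hκ⟩ := ramsey_params b K c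
  refine ⟨⟨_, hiso F hF⟩, ?_⟩
  have hsub : (χ '' {p | ∃ f₀ : {f : M → U // Isometry f},
      p.val = (fun u => r (P u, F (W u))) ∘ f₀.val}) ⊆ Set.range κ₀ := by
    rintro _ ⟨p, ⟨f₀, hp⟩, rfl⟩
    obtain ⟨u, hu, j, a, hja⟩ := envelope b (fun x => W (f₀.val x)) (fun x => hW _)
    let sh : Shape := fun x => (P (f₀.val x), j x, a x)
    have e : Φ sh (F u) = p.val := by
      rw [hp]
      funext x
      obtain ⟨s, q, h1, h2, h3⟩ := hja x
      obtain ⟨s', hs'⟩ := hF.ext' s (b + (j x : ℕ)) q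
      have h4 : b + (j x : ℕ) ∉ F q := by
        intro h
        rcases hF.letters h with h | h
        · omega
        · exact h2 h
      have h5 : trunc (b + (j x : ℕ)) (F u) = F q := by
        rw [h1, hs', trunc_eq h4]
      have h6 : F (W (f₀.val x)) = (F q).map (shapeSubst b K (a x)) := by
        have := hF.nat (shapeSubst b K (a x)) (fun y hy => by simp [shapeSubst, hy]) q
        rw [← this]
        exact congrArg F h3
      simp only [Φ, sh, Function.comp_apply, h5, h6]
    refine ⟨sh, ?_⟩
    rw [← hκ u hu]
    have h7 : Isometry (Φ sh (F u)) := by rw [e]; exact p.2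
    simp only [c, dif_pos h7]
    congr 1
    exact Subtype.ext e
  calc _ ≤ (Set.range κ₀).ncard := Set.ncard_le_ncard hsub (Set.toFinite _)
    _ ≤ Nat.card Shape := by
      rw [← Set.image_univ, ← Set.ncard_univ]
      exact Set.ncard_image_le (Set.toFinite _)
    _ ≤ _ := Nat.le_succ _

theorem stmt19 (S : Finset ℝ) (h0 : (0 : ℝ) ∈ S) (hnn : ∀ s ∈ S, 0 ≤ s)
    (s1 : ℝ) (hs1S : s1 ∈ S) (hs1pos : 0 < s1)
    (hs1min : ∀ s ∈ S, s ≠ 0 → s1 ≤ s)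
    (hcds : CompactDistanceSet S s1)
    -- `S` has at least two nontrivial blocks (`k ≥ 2`)
    (htwo : ∃ x ∈ S, x ≠ 0 ∧ ¬ SameBlock S x s1)
    -- `L` is a finite `S⁺`-metric space, `S⁺ = S∖B₁`
    (L : Type) [MetricSpace L] (hLfin : Finite L)
    (hLS : ∀ x y : L, dist x y ∈ S)
    (hLplus : ∀ x y : L, dist x y = 0 ∨ ¬ SameBlock S (dist x y) s1)
    -- `U` is a countably infinite `S`-metric space spanned by `L` ...
    (U : Type) [MetricSpace U] (hUc : Countable U) (hUi : Infinite U)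
    (hUS : ∀ x y : U, dist x y ∈ S) (hUsp : Spans S s1 L U)
    -- ... (i) universal for finite `S`-metric spaces spanned by `L` ...
    (huniv : ∀ (A : Type) [MetricSpace A], Finite A →
      (∀ x y : A, dist x y ∈ S) → Spans S s1 L A → ∃ f : A → U, Isometry f)
    -- ... and (ii) ultrahomogeneous
    (hultra : ∀ (A : Type) [MetricSpace A], Finite A →
      (∀ x y : A, dist x y ∈ S) → Spans S s1 L A →
      ∀ (f g : A → U), Isometry f → Isometry g →
        ∃ h : U → U, Isometry h ∧ Function.Surjective h ∧ ∀ a : A, f a = h (g a))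
    -- a finite `S`-metric space `M` spanned by `L`
    (M : Type) [MetricSpace M] (hMfin : Finite M)
    (hMS : ∀ x y : M, dist x y ∈ S) (hMsp : Spans S s1 L M) :
    ∃ T : ℕ, 0 < T ∧ ∀ k, 2 ≤ k →
      ∀ χ : {f : M → U // Isometry f} → Fin k,
        ∃ w : {g : U → U // Isometry g},
          (χ '' {p | ∃ f₀ : {f : M → U // Isometry f},
            p.val = w.val ∘ f₀.val}).ncard ≤ T := by
  obtain ⟨τ, hτ, hex⟩ := hUsp
  choose P hP hPu using hex
  have H : SHyp S s1 := ⟨h0, hnn, hs1S, hs1pos, hs1min, hcds⟩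
  have hP' : ∀ m, InLowBlock S s1 (dist m (τ (P m))) := hP
  exact main_coloring H hLS hUS P (fun x y hxy => part_nb H hLS hUS hτ hP' hxy)
    (fun F ℓ g hg => ext_prop H L hLfin hLS hLplus U hUS huniv hultra τ hτ P hP'
      (fun m a h => hPu m a h) F ℓ g hg) M
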